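/- Let d ≥ 2 and let U ⊆ ℂ be compact. Then the set {a : Fin (d−1) → ℂ | ∀ z : ℂ, (p_a).derivative.IsRoot z → (p_a).eval z ∈ U} of (coefficient vectors of) monic centered degree-d polynomials all of whose critical values lie in U is a compact subset of Fin (d−1) → ℂ. -/

import Mathlib

open Polynomial

/-- The monic centered polynomial `X^d + ∑_{i=0}^{d-2} (a i)·X^i` determined by the
coefficient vector `a`. -/
noncomputable def mcPoly (d : ℕ) (a : Fin (d - 1) → ℂ) : ℂ[X] :=
  X ^ d + ∑ i : Fin (d - 1), C (a i) * X ^ (i : ℕ)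

open Filter Topology

/-- Some root `w` of a complex polynomial of degree `n > 0` is within distance
`(‖p z‖ / ‖p.leadingCoeff‖) ^ (1 / n)` of a given point `z`. -/
lemma exists_isRoot_norm_sub_pow_le (p : ℂ[X]) (hp : p.natDegree ≠ 0) (z : ℂ) :
    ∃ w, p.IsRoot w ∧ ‖p.leadingCoeff‖ * ‖z - w‖ ^ p.natDegree ≤ ‖p.eval z‖ := by
  have hs := IsAlgClosed.splits p
  have hp0 : p ≠ 0 := by rintro rfl; simp at hp
  have hne : p.roots.toFinset.Nonempty := by
    rw [Multiset.toFinset_nonempty]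
    exact hs.roots_ne_zero hp
  obtain ⟨w, hw, hmin⟩ := p.roots.toFinset.exists_min_image (fun w ↦ ‖z - w‖) hne
  refine ⟨w, isRoot_of_mem_roots (Multiset.mem_toFinset.mp hw), ?_⟩
  have hprod : ‖p.eval z‖ = ‖p.leadingCoeff‖ * (p.roots.map fun x ↦ ‖z - x‖).prod := by
    rw [hs.eval_eq_prod_roots, norm_mul]
    congr 1
    exact (Multiset.prod_hom' p.roots (normHom : ℂ →*₀ ℝ) (fun x ↦ z - x)).symm
  rw [hprod]
  gcongr
  have h := Multiset.prod_map_le_prod_map₀ (s := p.roots) (fun _ ↦ ‖z - w‖) (fun x ↦ ‖z - x‖)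
    (fun _ _ ↦ norm_nonneg _) (fun x hx ↦ hmin x (Multiset.mem_toFinset.mpr hx))
  simpa [← hs.natDegree_eq_card_roots] using h

/-- A complex polynomial all of whose critical points are roots has at most one root. -/
lemma roots_eq_replicate_of_isRoot_of_isRoot_derivative (p : ℂ[X]) (hp : p.natDegree ≠ 0)
    (h : ∀ z, p.derivative.IsRoot z → p.IsRoot z) :
    ∃ c, p.roots = Multiset.replicate p.natDegree c := by
  have hs := IsAlgClosed.splits p
  have hp0 : p ≠ 0 := by rintro rfl; simp at hp
  have hd0 : p.derivative ≠ 0 := fun h0 ↦ hp (derivative_eq_zero.mp h0)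
  have hd : p.derivative.roots.card = p.natDegree - 1 := by
    rw [← (IsAlgClosed.splits p.derivative).natDegree_eq_card_roots, natDegree_derivative]
  have hcount : p.derivative.roots + p.roots.toFinset.val = p.roots := by
    ext z
    rw [Multiset.count_add, count_roots, count_roots]
    by_cases hz : p.IsRoot z
    · have hmem : z ∈ p.roots.toFinset := by simpa [hp0] using hz
      rw [derivative_rootMultiplicity_of_root hz,
        Multiset.count_eq_one_of_mem p.roots.toFinset.nodup hmem]
      have := (rootMultiplicity_pos hp0).mpr hz
      omega
    · have hmem : z ∉ p.roots.toFinset.val := by simpa [hp0] using hz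
      rw [Multiset.count_eq_zero_of_notMem hmem, rootMultiplicity_eq_zero hz,
        rootMultiplicity_eq_zero (mt (h z) hz)]
  have hcard : p.roots.toFinset.card = 1 := by
    have := congrArg Multiset.card hcount
    rw [Multiset.card_add, hd, ← hs.natDegree_eq_card_roots] at this
    rw [Finset.card_def]
    omega
  obtain ⟨c, hc⟩ := Finset.card_eq_one.mp hcard
  refine ⟨c, Multiset.eq_replicate.mpr ⟨hs.natDegree_eq_card_roots.symm, fun b hb ↦ ?_⟩⟩
  simpa [hc] using Multiset.mem_toFinset.mpr hb

section mcPoly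

variable {d : ℕ}

lemma mcPoly_monic (hd : 2 ≤ d) (a : Fin (d - 1) → ℂ) : (mcPoly d a).Monic :=
  monic_X_pow_add ((degree_sum_fin_lt a).trans (by exact_mod_cast (by omega : d - 1 < d)))

lemma natDegree_mcPoly (hd : 2 ≤ d) (a : Fin (d - 1) → ℂ) : (mcPoly d a).natDegree = d := by
  have h : (∑ i : Fin (d - 1), C (a i) * X ^ (i : ℕ) : ℂ[X]).degree < (X ^ d : ℂ[X]).degree := by
    rw [degree_X_pow]
    exact (degree_sum_fin_lt a).trans (by exact_mod_cast (by omega : d - 1 < d))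
  rw [mcPoly, natDegree_add_eq_left_of_degree_lt h, natDegree_X_pow]

lemma coeff_mcPoly (a : Fin (d - 1) → ℂ) (i : Fin (d - 1)) :
    (mcPoly d a).coeff i = a i := by
  have hi : (i : ℕ) ≠ d := by omega
  simp [mcPoly, finsetSum_coeff, coeff_X_pow, hi, Fin.val_inj]

lemma nextCoeff_mcPoly (hd : 2 ≤ d) (a : Fin (d - 1) → ℂ) : (mcPoly d a).nextCoeff = 0 := by
  rw [nextCoeff_of_natDegree_pos (by rw [natDegree_mcPoly hd]; omega), natDegree_mcPoly hd, mcPoly,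
    coeff_add, coeff_eq_zero_of_degree_lt (degree_sum_fin_lt a), coeff_X_pow,
    if_neg (by omega), add_zero]

lemma eval_mcPoly (a : Fin (d - 1) → ℂ) (z : ℂ) :
    (mcPoly d a).eval z = z ^ d + ∑ i : Fin (d - 1), a i * z ^ (i : ℕ) := by
  simp [mcPoly, eval_finsetSum]

lemma eval_derivative_mcPoly (a : Fin (d - 1) → ℂ) (z : ℂ) :
    (mcPoly d a).derivative.eval z =
      d * z ^ (d - 1) + ∑ i : Fin (d - 1), a i * ((i : ℕ) * z ^ ((i : ℕ) - 1)) := by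
  simp [mcPoly, eval_finsetSum, derivative_X_pow]

lemma continuous_eval_mcPoly :
    Continuous fun q : (Fin (d - 1) → ℂ) × ℂ ↦ (mcPoly d q.1).eval q.2 := by
  simp only [eval_mcPoly]
  fun_prop

lemma continuous_eval_derivative_mcPoly :
    Continuous fun q : (Fin (d - 1) → ℂ) × ℂ ↦ (mcPoly d q.1).derivative.eval q.2 := by
  simp only [eval_derivative_mcPoly]
  fun_prop

/-- Only `X ^ d` has all its critical values equal to zero. -/
lemma eq_zero_of_critical_values_eq_zero (hd : 2 ≤ d) (a : Fin (d - 1) → ℂ)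
    (h : ∀ z, (mcPoly d a).derivative.IsRoot z → (mcPoly d a).eval z = 0) : a = 0 := by
  have hdeg := natDegree_mcPoly hd a
  have hm := mcPoly_monic hd a
  have hs := IsAlgClosed.splits (mcPoly d a)
  obtain ⟨c, hc⟩ := roots_eq_replicate_of_isRoot_of_isRoot_derivative (mcPoly d a) (by omega) h
  rw [hdeg] at hc
  have hsum := hs.nextCoeff_eq_neg_sum_roots_of_monic hm
  rw [nextCoeff_mcPoly hd, hc, Multiset.sum_replicate, nsmul_eq_mul, eq_comm, neg_eq_zero,
    mul_eq_zero, Nat.cast_eq_zero] at hsum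
  have hc0 : c = 0 := hsum.resolve_left (by omega)
  have hX : mcPoly d a = X ^ d := by
    rw [hs.eq_prod_roots_of_monic hm, hc, hc0]
    simp
  ext i
  rw [← coeff_mcPoly a i, hX, coeff_X_pow, if_neg (by omega), Pi.zero_apply]

/-- Critical values depend continuously on the polynomial: every critical value of a limit is a
limit of critical values. -/
lemma exists_critical_values_tendsto (hd : 2 ≤ d) {u : ℕ → Fin (d - 1) → ℂ}
    {a : Fin (d - 1) → ℂ} (hu : Tendsto u atTop (𝓝 a)) {z : ℂ}
    (hz : (mcPoly d a).derivative.IsRoot z) :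
    ∃ w : ℕ → ℂ, (∀ n, (mcPoly d (u n)).derivative.IsRoot (w n)) ∧
      Tendsto (fun n ↦ (mcPoly d (u n)).eval (w n)) atTop (𝓝 ((mcPoly d a).eval z)) := by
  have hdeg (b : Fin (d - 1) → ℂ) : (mcPoly d b).derivative.natDegree = d - 1 := by
    rw [natDegree_derivative, natDegree_mcPoly hd]
  have hlead (b : Fin (d - 1) → ℂ) : (mcPoly d b).derivative.leadingCoeff = d := by
    rw [leadingCoeff, hdeg, coeff_derivative, Nat.sub_add_cancel (by omega)]
    have := (mcPoly_monic hd b).coeff_natDegree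
    rw [natDegree_mcPoly hd] at this
    rw [this, one_mul, Nat.cast_sub (by omega)]
    simp
  choose w hw hle using fun n ↦ exists_isRoot_norm_sub_pow_le (mcPoly d (u n)).derivative
    (by rw [hdeg]; omega) z
  refine ⟨w, hw, ?_⟩
  have hlim : Tendsto (fun n ↦ ‖(mcPoly d (u n)).derivative.eval z‖) atTop (𝓝 0) := by
    have := ((continuous_eval_derivative_mcPoly.tendsto (a, z)).comp
      (hu.prodMk_nhds tendsto_const_nhds)).norm
    simpa [Function.comp_def, hz.eq_zero] using this
  have hwz : Tendsto w atTop (𝓝 z) := by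
    rw [Metric.tendsto_atTop']
    intro ε hε
    obtain ⟨N, hN⟩ := eventually_atTop.mp (hlim.eventually_lt_const (pow_pos hε (d - 1)))
    refine ⟨N, fun n hn ↦ ?_⟩
    rw [dist_comm, dist_eq_norm]
    refine lt_of_pow_lt_pow_left₀ (d - 1) hε.le (lt_of_le_of_lt ?_ (hN n hn.le))
    have h := hle n
    rw [hdeg, hlead, Complex.norm_natCast] at h
    refine le_trans (le_mul_of_one_le_left (by positivity) ?_) h
    exact_mod_cast (by omega : 1 ≤ d)
  exact (continuous_eval_mcPoly.tendsto (a, z)).comp (hu.prodMk_nhds hwz)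

/-- The critical values of the polynomials of norm-one coefficient vector are not all small. -/
lemma exists_critical_value_gt_of_norm_eq_one (hd : 2 ≤ d) :
    ∃ ε > 0, ∀ a : Fin (d - 1) → ℂ, ‖a‖ = 1 →
      ∃ z, (mcPoly d a).derivative.IsRoot z ∧ ε < ‖(mcPoly d a).eval z‖ := by
  by_contra! h
  choose u hu hsmall using fun n : ℕ ↦ h (1 / ((n : ℝ) + 1)) (by positivity)
  obtain ⟨a, ha, φ, hφ, hlim⟩ := (isCompact_sphere (0 : Fin (d - 1) → ℂ) 1).tendsto_subseq
    (x := u) (fun n ↦ by simp [hu])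
  have ha0 : a = 0 := by
    refine eq_zero_of_critical_values_eq_zero hd a fun z hz ↦ ?_
    obtain ⟨w, hw, hwlim⟩ := exists_critical_values_tendsto hd hlim hz
    refine tendsto_nhds_unique hwlim (squeeze_zero_norm (fun n ↦ hsmall (φ n) (w n) (hw n)) ?_)
    exact tendsto_one_div_add_atTop_nhds_zero_nat.comp hφ.tendsto_atTop
  simp [ha0] at ha

lemma eval_mcPoly_smul (t : ℂ) (a : Fin (d - 1) → ℂ) (z : ℂ) :
    (mcPoly d fun i ↦ t ^ (d - i : ℕ) * a i).eval (t * z) = t ^ d * (mcPoly d a).eval z := by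
  rw [eval_mcPoly, eval_mcPoly, mul_add, mul_pow, Finset.mul_sum]
  congr 1
  refine Finset.sum_congr rfl fun i _ ↦ ?_
  have : t ^ d = t ^ (d - i : ℕ) * t ^ (i : ℕ) := by rw [← pow_add]; congr 1; omega
  rw [this, mul_pow]
  ring

lemma comp_mcPoly_smul (t : ℂ) (a : Fin (d - 1) → ℂ) :
    (mcPoly d fun i ↦ t ^ (d - i : ℕ) * a i).comp (C t * X) = C (t ^ d) * mcPoly d a := by
  refine Polynomial.funext fun z ↦ ?_
  simpa using eval_mcPoly_smul t a z

lemma isRoot_derivative_mcPoly_smul {t : ℂ} (ht : t ≠ 0) (a : Fin (d - 1) → ℂ) (z : ℂ)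
    (hz : (mcPoly d fun i ↦ t ^ (d - i : ℕ) * a i).derivative.IsRoot (t * z)) :
    (mcPoly d a).derivative.IsRoot z := by
  have h := congrArg (fun p ↦ p.derivative.eval z) (comp_mcPoly_smul t a)
  simp only [derivative_comp, derivative_C_mul, derivative_X, mul_one, eval_mul, eval_C, eval_comp,
    eval_X, hz.eq_zero, mul_zero] at h
  exact (mul_eq_zero.mp h.symm).resolve_left (pow_ne_zero d ht)

/-- A bound on the critical values bounds the coefficients. -/
lemma exists_norm_le_of_critical_values_le (hd : 2 ≤ d) (R : ℝ) :
    ∃ M, ∀ a : Fin (d - 1) → ℂ,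
      (∀ z, (mcPoly d a).derivative.IsRoot z → ‖(mcPoly d a).eval z‖ ≤ R) → ‖a‖ ≤ M := by
  obtain ⟨ε, hε, hcrit⟩ := exists_critical_value_gt_of_norm_eq_one hd
  refine ⟨max 1 (R / ε), fun a ha ↦ ?_⟩
  by_contra! hlt
  obtain ⟨h1, hR⟩ := max_lt_iff.mp hlt
  have hcont : Continuous fun t : ℝ ↦ ‖fun i : Fin (d - 1) ↦ (t : ℂ) ^ (d - i : ℕ) * a i‖ := by
    fun_prop
  obtain ⟨t, ⟨ht0, ht1⟩, ht⟩ : (1 : ℝ) ∈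
      (fun t : ℝ ↦ ‖fun i : Fin (d - 1) ↦ (t : ℂ) ^ (d - i : ℕ) * a i‖) '' Set.Icc 0 1 := by
    refine intermediate_value_Icc zero_le_one hcont.continuousOn ⟨?_, by simpa using h1.le⟩
    have h0 : (fun i : Fin (d - 1) ↦ ((0 : ℝ) : ℂ) ^ (d - i : ℕ) * a i) = 0 := by
      ext i
      simp [show d - (i : ℕ) ≠ 0 by omega]
    simp only [h0, norm_zero, zero_le_one]
  have htne : (t : ℂ) ≠ 0 := by
    intro h0
    have h0' : (fun i : Fin (d - 1) ↦ (t : ℂ) ^ (d - i : ℕ) * a i) = 0 := by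
      ext i
      simp [h0, show d - (i : ℕ) ≠ 0 by omega]
    simp [h0'] at ht
  have htpos : 0 < t := lt_of_le_of_ne ht0 fun h ↦ htne (by simp [← h])
  obtain ⟨y, hy, hlarge⟩ := hcrit _ ht
  obtain ⟨z, rfl⟩ : ∃ z, y = t * z := ⟨y / t, by field_simp⟩
  have hz := ha z (isRoot_derivative_mcPoly_smul htne a z hy)
  rw [eval_mcPoly_smul, norm_mul, norm_pow, Complex.norm_of_nonneg ht0] at hlarge
  have hbound : t ^ d * ‖a‖ ≤ 1 := by
    have : ‖a‖ ≤ 1 / t ^ d := by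
      refine (pi_norm_le_iff_of_nonneg (by positivity)).mpr fun i ↦ ?_
      rw [le_div_iff₀ (by positivity)]
      have hi := norm_le_pi_norm (fun i : Fin (d - 1) ↦ (t : ℂ) ^ (d - i : ℕ) * a i) i
      simp only [ht, norm_mul, norm_pow, Complex.norm_of_nonneg ht0] at hi
      calc ‖a i‖ * t ^ d ≤ ‖a i‖ * t ^ (d - i : ℕ) := by
            gcongr ?_ * ?_
            exact pow_le_pow_of_le_one ht0 ht1 (Nat.sub_le _ _)
        _ ≤ 1 := by rwa [mul_comm]
    rwa [le_div_iff₀ (by positivity), mul_comm] at this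
  rw [div_lt_iff₀ hε] at hR
  have htd : 0 < t ^ d := by positivity
  have h2 : t ^ d * ‖(mcPoly d a).eval z‖ < t ^ d * (‖a‖ * ε) := by
    gcongr
    linarith
  have h3 : t ^ d * ‖a‖ * ε ≤ 1 * ε := by gcongr
  linarith

end mcPoly

/-- For compact `U ⊆ ℂ`, the set of monic centered degree-`d` polynomials all of whose
critical values lie in `U` is compact. -/
theorem stmt_14 (d : ℕ) (hd : 2 ≤ d) (U : Set ℂ) (hU : IsCompact U) :
    IsCompact {a : Fin (d - 1) → ℂ |
      ∀ z : ℂ, (mcPoly d a).derivative.IsRoot z → (mcPoly d a).eval z ∈ U} := by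
  refine Metric.isCompact_of_isClosed_isBounded ?_ ?_
  · refine IsSeqClosed.isClosed fun u a hu hlim z hz ↦ ?_
    obtain ⟨w, hw, hwlim⟩ := exists_critical_values_tendsto hd hlim hz
    exact hU.isClosed.mem_of_tendsto hwlim (.of_forall fun n ↦ hu n (w n) (hw n))
  · obtain ⟨R, hR⟩ := hU.isBounded.exists_norm_le
    obtain ⟨M, hM⟩ := exists_norm_le_of_critical_values_le hd R
    exact isBounded_iff_forall_norm_le.mpr ⟨M, fun a ha ↦ hM a fun z hz ↦ hR _ (ha z hz)⟩
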